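/- arXiv:2110.12071 — 2 statements merged into one kernel-verified Lean document; each statement's English description precedes it below -/
import Mathlib

section
/- For any β > 0, nonnegative integer d, and integer t ≥ β, one has 2 e^{-β} ∑_{j=d+1}^∞ I_j(β) ≤ 2 e^{-(d+1)²/(2t)} + (1/2)(eβ/t)^t e^{-β}. -/
/-- The modified Bessel function of the first kind, of integer order `j ≥ 0`. -/
noncomputable def besselI (j : ℕ) (β : ℝ) : ℝ :=
  ∑' m : ℕ, (Nat.choose (2 * m + j) m : ℝ) * (β / 2) ^ (2 * m + j) / Nat.factorial (2 * m + j)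

open Finset

/-- The summand of `besselI j β`, as a function of the order `j` and the summation index `k`. -/
noncomputable def besselTerm (β : ℝ) (j k : ℕ) : ℝ :=
  (Nat.choose (2 * k + j) k : ℝ) * (β / 2) ^ (2 * k + j) / Nat.factorial (2 * k + j)

theorem one_sub_mul_exp_le_one_add_mul_exp_neg {u : ℝ} (hu : 0 ≤ u) :
    (1 - u) * Real.exp u ≤ (1 + u) * Real.exp (-u) := by
  have hd : ∀ x : ℝ, HasDerivAt (fun x : ℝ => (1 + x) * Real.exp (-x) - (1 - x) * Real.exp x)
      (x * (Real.exp x - Real.exp (-x))) x := by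
    intro x
    have h1 := ((hasDerivAt_id x).const_add 1).mul (hasDerivAt_neg x).exp
    have h2 := ((hasDerivAt_id x).const_sub 1).mul (Real.hasDerivAt_exp x)
    refine (h1.sub h2).congr_deriv ?_
    simp only [id]
    ring
  have hmono : MonotoneOn (fun x : ℝ => (1 + x) * Real.exp (-x) - (1 - x) * Real.exp x)
      (Set.Ici 0) := by
    refine monotoneOn_of_deriv_nonneg (convex_Ici 0)
      (fun x _ => (hd x).continuousAt.continuousWithinAt)
      (fun x _ => (hd x).differentiableAt.differentiableWithinAt) fun x hx => ?_
    rw [interior_Ici, Set.mem_Ioi] at hx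
    rw [(hd x).deriv]
    refine mul_nonneg hx.le (sub_nonneg.2 (Real.exp_le_exp.2 ?_))
    linarith
  have h := hmono Set.self_mem_Ici hu hu
  norm_num at h
  exact h

theorem sub_pow_mul_exp_le_add_pow_mul_exp (t : ℕ) {s : ℝ} (hs : 0 ≤ s) (hst : s ≤ t) :
    (t - s) ^ t * Real.exp (-(t - s)) ≤ (t + s) ^ t * Real.exp (-(t + s)) := by
  rcases Nat.eq_zero_or_pos t with rfl | htpos
  · have : s = 0 := le_antisymm (by simpa using hst) hs
    simp [this]
  have ht : (0 : ℝ) < t := by exact_mod_cast htpos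
  have key := one_sub_mul_exp_le_one_add_mul_exp_neg (div_nonneg hs ht.le)
  have hnn : 0 ≤ t * ((1 - s / t) * Real.exp (s / t)) :=
    mul_nonneg ht.le (mul_nonneg (sub_nonneg.2 ((div_le_one ht).2 hst)) (Real.exp_pos _).le)
  have hpow := pow_le_pow_left₀ hnn (mul_le_mul_of_nonneg_left key ht.le) t
  rw [← mul_assoc, ← mul_assoc, mul_pow _ (Real.exp _), mul_pow _ (Real.exp _),
    ← Real.exp_nat_mul, ← Real.exp_nat_mul] at hpow
  have e1 : (t : ℝ) * (1 - s / t) = t - s := by field_simp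
  have e2 : (t : ℝ) * (1 + s / t) = t + s := by field_simp
  have e3 : (t : ℝ) * (s / t) = s := by field_simp
  have e4 : (t : ℝ) * -(s / t) = -s := by field_simp
  rw [e1, e2, e3, e4] at hpow
  have h := mul_le_mul_of_nonneg_right hpow (Real.exp_pos (-(t : ℝ))).le
  rw [mul_assoc, mul_assoc, ← Real.exp_add, ← Real.exp_add] at h
  have e5 : -((t : ℝ) - s) = s + -t := by ring
  have e6 : -((t : ℝ) + s) = -s + -t := by ring
  rwa [e5, e6]

theorem hasDerivAt_exp_neg_mul_sum_pow_div_factorial (t : ℕ) (x : ℝ) :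
    HasDerivAt (fun x : ℝ => Real.exp (-x) * ∑ n ∈ range (t + 1), x ^ n / n.factorial)
      (-(x ^ t * Real.exp (-x) / t.factorial)) x := by
  induction t with
  | zero => simpa using (hasDerivAt_neg x).exp
  | succ t ih =>
    have hterm := (hasDerivAt_neg x).exp.mul
      ((hasDerivAt_pow (t + 1) x).div_const ((t + 1).factorial : ℝ))
    have hfun : (fun x : ℝ => Real.exp (-x) * ∑ n ∈ range (t + 1 + 1), x ^ n / n.factorial) =
        (fun x : ℝ => Real.exp (-x) * ∑ n ∈ range (t + 1), x ^ n / n.factorial) +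
        ((fun x : ℝ => Real.exp (-x)) * fun x : ℝ => x ^ (t + 1) / (t + 1).factorial) := by
      funext y
      simp only [Pi.add_apply, Pi.mul_apply]
      rw [sum_range_succ _ (t + 1), mul_add]
    rw [hfun]
    refine (ih.add hterm).congr_deriv ?_
    have hf : (t.factorial : ℝ) ≠ 0 := by exact_mod_cast t.factorial_ne_zero
    have ht : (t : ℝ) + 1 ≠ 0 := by positivity
    rw [Nat.factorial_succ]
    push_cast
    field_simp
    ring

/-- The median of a Poisson variable of integer mean `t` is at least `t`. -/
theorem half_exp_le_sum_pow_div_factorial (t : ℕ) :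
    Real.exp t / 2 ≤ ∑ n ∈ range (t + 1), (t : ℝ) ^ n / n.factorial := by
  set Q : ℝ → ℝ := fun x => Real.exp (-x) * ∑ n ∈ range (t + 1), x ^ n / n.factorial with hQ
  have hd : ∀ s : ℝ, HasDerivAt (fun s : ℝ => Q (t + s) + Q (t - s))
      (-((t + s) ^ t * Real.exp (-(t + s)) / t.factorial) +
        (t - s) ^ t * Real.exp (-(t - s)) / t.factorial) s := by
    intro s
    have h1 := (hasDerivAt_exp_neg_mul_sum_pow_div_factorial t (t + s)).comp_const_add (t : ℝ) s
    have h2 := (hasDerivAt_exp_neg_mul_sum_pow_div_factorial t (t - s)).comp_const_sub (t : ℝ) s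
    exact (h1.add h2).congr_deriv (by ring)
  have hanti : AntitoneOn (fun s : ℝ => Q (t + s) + Q (t - s)) (Set.Icc 0 (t : ℝ)) := by
    refine antitoneOn_of_deriv_nonpos (convex_Icc 0 (t : ℝ))
      (fun x _ => (hd x).continuousAt.continuousWithinAt)
      (fun x _ => (hd x).differentiableAt.differentiableWithinAt) fun s hs => ?_
    rw [interior_Icc, Set.mem_Ioo] at hs
    rw [(hd s).deriv]
    have := div_le_div_of_nonneg_right
      (sub_pow_mul_exp_le_add_pow_mul_exp t hs.1.le hs.2.le) (Nat.cast_nonneg (α := ℝ) t.factorial)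
    linarith
  have ht : (0 : ℝ) ≤ t := t.cast_nonneg
  have h := hanti (Set.left_mem_Icc.2 ht) (Set.right_mem_Icc.2 ht) ht
  have hQ0 : Q 0 = 1 := by simp [hQ, sum_range_succ']
  have hQ2 : 0 ≤ Q (t + t) := by
    simp only [hQ]
    positivity
  simp only [add_zero, sub_zero, sub_self, hQ0] at h
  have hQt : 1 / 2 ≤ Q t := by linarith
  have hmul := mul_le_mul_of_nonneg_left hQt (Real.exp_pos (t : ℝ)).le
  simp only [hQ] at hmul
  rw [← mul_assoc, ← Real.exp_add, add_neg_cancel, Real.exp_zero, one_mul] at hmul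
  linarith

theorem sum_Ico_pow_div_factorial_le {β : ℝ} (hβ : 0 < β) {t : ℕ} (ht : β ≤ t) (N : ℕ) :
    ∑ n ∈ Ico (t + 1) N, β ^ n / n.factorial ≤ (1 / 2) * (Real.exp 1 * β / t) ^ t := by
  have htpos : (0 : ℝ) < t := hβ.trans_le ht
  have hr0 : 0 ≤ β / t := by positivity
  have hr1 : β / t ≤ 1 := (div_le_one htpos).2 ht
  have hterm : ∀ n ∈ Ico (t + 1) N,
      β ^ n / n.factorial ≤ (β / t) ^ t * ((t : ℝ) ^ n / n.factorial) := by
    intro n hn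
    have htn : t ≤ n := by have := (mem_Ico.1 hn).1; omega
    rw [← mul_div_assoc]
    refine div_le_div_of_nonneg_right ?_ (Nat.cast_nonneg _)
    calc β ^ n = (β / t) ^ n * (t : ℝ) ^ n := by
          rw [← mul_pow, div_mul_cancel₀ _ htpos.ne']
      _ ≤ _ := mul_le_mul_of_nonneg_right (pow_le_pow_of_le_one hr0 hr1 htn) (by positivity)
  have htail : ∑ n ∈ Ico (t + 1) N, (t : ℝ) ^ n / n.factorial ≤ Real.exp t / 2 := by
    rcases le_total (t + 1) N with hN | hN
    · have h1 := sum_range_add_sum_Ico (fun n : ℕ => (t : ℝ) ^ n / n.factorial) hN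
      have h2 := Real.sum_le_exp_of_nonneg htpos.le N
      have h3 := half_exp_le_sum_pow_div_factorial t
      linarith
    · rw [Ico_eq_empty_of_le hN, sum_empty]
      positivity
  calc _ ≤ ∑ n ∈ Ico (t + 1) N, (β / t) ^ t * ((t : ℝ) ^ n / n.factorial) := sum_le_sum hterm
    _ = (β / t) ^ t * ∑ n ∈ Ico (t + 1) N, (t : ℝ) ^ n / n.factorial := (mul_sum ..).symm
    _ ≤ (β / t) ^ t * (Real.exp t / 2) := mul_le_mul_of_nonneg_left htail (by positivity)
    _ = _ := by
      rw [mul_div_assoc, mul_pow, ← Real.exp_nat_mul, mul_one]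
      ring

/-- Hoeffding's inequality for a sum of `n ≤ t` random signs, in counting form. -/
theorem sum_choose_le_two_pow_mul_exp {n t D : ℕ} (hn : n ≤ t) (ht : 0 < t) :
    ∑ k ∈ range (n + 1) with 2 * k + D ≤ n, (n.choose k : ℝ) ≤
      2 ^ n * Real.exp (-(D : ℝ) ^ 2 / (2 * t)) := by
  have ht' : (0 : ℝ) < t := by exact_mod_cast ht
  have hn' : (n : ℝ) ≤ t := by exact_mod_cast hn
  set l : ℝ := D / t with hl
  have hl0 : 0 ≤ l := by positivity
  calc ∑ k ∈ range (n + 1) with 2 * k + D ≤ n, (n.choose k : ℝ)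
      ≤ ∑ k ∈ range (n + 1) with 2 * k + D ≤ n,
          Real.exp (-(l * D)) * (Real.exp (-l) ^ k * Real.exp l ^ (n - k) * n.choose k) := by
        refine sum_le_sum fun k hk => ?_
        obtain ⟨hk1, hk2⟩ := mem_filter.1 hk
        rw [← mul_assoc, ← Real.exp_nat_mul, ← Real.exp_nat_mul, ← Real.exp_add, ← Real.exp_add]
        refine le_mul_of_one_le_left (Nat.cast_nonneg _) (Real.one_le_exp ?_)
        have hk3 : (2 * k + D : ℝ) ≤ n := by exact_mod_cast hk2
        rw [Nat.cast_sub (by omega)]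
        nlinarith [mul_nonneg hl0 (sub_nonneg.2 hk3)]
    _ ≤ ∑ k ∈ range (n + 1),
          Real.exp (-(l * D)) * (Real.exp (-l) ^ k * Real.exp l ^ (n - k) * n.choose k) :=
        sum_le_sum_of_subset_of_nonneg (filter_subset _ _) fun _ _ _ => by positivity
    _ = Real.exp (-(l * D)) * (2 ^ n * Real.cosh l ^ n) := by
        rw [← mul_sum, ← add_pow, ← mul_pow, Real.cosh_eq]
        congr 2
        ring
    _ ≤ Real.exp (-(l * D)) * (2 ^ n * Real.exp (l ^ 2 / 2) ^ n) := by
        gcongr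
        exact Real.cosh_le_exp_half_sq l
    _ = 2 ^ n * Real.exp (-(l * D) + n * (l ^ 2 / 2)) := by
        rw [← Real.exp_nat_mul, Real.exp_add]
        ring
    _ ≤ 2 ^ n * Real.exp (-(D : ℝ) ^ 2 / (2 * t)) := by
        gcongr
        have h1 : (n : ℝ) * (l ^ 2 / 2) ≤ t * (l ^ 2 / 2) := by gcongr
        have h2 : -(l * D) + t * (l ^ 2 / 2) = -(D : ℝ) ^ 2 / (2 * t) := by
          rw [hl]
          field_simp
          ring
        linarith

theorem sum_choose_le_half_two_pow {n D : ℕ} (hD : 0 < D) :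
    ∑ k ∈ range (n + 1) with 2 * k + D ≤ n, (n.choose k : ℝ) ≤ 2 ^ n * (1 / 2) := by
  have hsum : ∑ k ∈ range (n + 1), (n.choose k : ℝ) = 2 ^ n := by
    exact_mod_cast Nat.sum_range_choose n
  have hreflect : ∑ k ∈ range (n + 1), (if 2 * k + D ≤ n then (n.choose k : ℝ) else 0) =
      ∑ k ∈ range (n + 1), (if n + D ≤ 2 * k then (n.choose k : ℝ) else 0) := by
    rw [← sum_range_reflect]
    refine sum_congr rfl fun k hk => ?_
    have hk' : k ≤ n := by have := mem_range.1 hk; omega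
    have e : n + 1 - 1 - k = n - k := by omega
    rw [e, Nat.choose_symm hk']
    exact if_congr (by omega) rfl rfl
  have hle : ∑ k ∈ range (n + 1), (if 2 * k + D ≤ n then (n.choose k : ℝ) else 0) +
      ∑ k ∈ range (n + 1), (if n + D ≤ 2 * k then (n.choose k : ℝ) else 0) ≤ 2 ^ n := by
    rw [← sum_add_distrib, ← hsum]
    refine sum_le_sum fun k _ => ?_
    have : (0 : ℝ) ≤ n.choose k := Nat.cast_nonneg _
    split_ifs
    · omega
    all_goals linarith
  rw [sum_filter]
  linarith

theorem besselTerm_nonneg {β : ℝ} (hβ : 0 < β) (j k : ℕ) : 0 ≤ besselTerm β j k := by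
  unfold besselTerm
  positivity

/-- Collecting the terms of the Bessel functions of order at least `D` by powers of `β`. -/
theorem sum_besselTerm_le {β : ℝ} (hβ : 0 < β) (D : ℕ) (s : Finset (ℕ × ℕ)) :
    ∃ N, ∑ p ∈ s, besselTerm β (D + p.1) p.2 ≤
      ∑ n ∈ range N, (β ^ n / n.factorial) *
        ((∑ k ∈ range (n + 1) with 2 * k + D ≤ n, (n.choose k : ℝ)) / 2 ^ n) := by
  let g : ℕ × ℕ → ℕ := fun p => 2 * p.2 + (D + p.1)
  refine ⟨s.sup g + 1, ?_⟩
  rw [← sum_fiberwise_of_maps_to (g := g) (t := range (s.sup g + 1))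
    fun p hp => mem_range.2 (Nat.lt_succ_of_le (le_sup hp))]
  refine sum_le_sum fun n _ => ?_
  have hterm : ∀ p ∈ s.filter (fun p => g p = n),
      besselTerm β (D + p.1) p.2 = β ^ n / n.factorial / 2 ^ n * n.choose p.2 := by
    intro p hp
    have hg : 2 * p.2 + (D + p.1) = n := (mem_filter.1 hp).2
    rw [besselTerm, hg, div_pow]
    ring
  have hinj : Set.InjOn Prod.snd (s.filter (fun p => g p = n) : Set (ℕ × ℕ)) := by
    rintro ⟨a, b⟩ hp ⟨c, e⟩ hq h
    have h1 : 2 * b + (D + a) = n := (mem_filter.1 hp).2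
    have h2 : 2 * e + (D + c) = n := (mem_filter.1 hq).2
    have h3 : b = e := h
    ext <;> simp only <;> omega
  have himage : (s.filter (fun p => g p = n)).image Prod.snd ⊆
      (range (n + 1)).filter (fun k => 2 * k + D ≤ n) := by
    intro k hk
    obtain ⟨p, hp, rfl⟩ := mem_image.1 hk
    have hg : 2 * p.2 + (D + p.1) = n := (mem_filter.1 hp).2
    simp only [mem_filter, mem_range]
    omega
  calc _ = β ^ n / n.factorial / 2 ^ n *
        ∑ p ∈ s with g p = n, (n.choose p.2 : ℝ) := by
        rw [sum_congr rfl hterm, mul_sum]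
    _ = β ^ n / n.factorial / 2 ^ n *
        ∑ k ∈ (s.filter (fun p => g p = n)).image Prod.snd, (n.choose k : ℝ) := by
        rw [sum_image hinj]
    _ ≤ β ^ n / n.factorial / 2 ^ n *
        ∑ k ∈ range (n + 1) with 2 * k + D ≤ n, (n.choose k : ℝ) := by
        refine mul_le_mul_of_nonneg_left ?_ (by positivity)
        exact sum_le_sum_of_subset_of_nonneg himage fun _ _ _ => Nat.cast_nonneg _
    _ = _ := by ring

theorem sum_besselTerm_le_exp_add {β : ℝ} (hβ : 0 < β) {D t : ℕ} (hD : 0 < D) (ht : β ≤ t)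
    (s : Finset (ℕ × ℕ)) :
    ∑ p ∈ s, besselTerm β (D + p.1) p.2 ≤
      Real.exp β * Real.exp (-(D : ℝ) ^ 2 / (2 * t)) +
        (1 / 4) * (Real.exp 1 * β / t) ^ t := by
  have htpos : 0 < t := by exact_mod_cast hβ.trans_le ht
  obtain ⟨N, hN⟩ := sum_besselTerm_le hβ D s
  set T : ℕ → ℝ := fun n => (β ^ n / n.factorial) *
    ((∑ k ∈ range (n + 1) with 2 * k + D ≤ n, (n.choose k : ℝ)) / 2 ^ n) with hT
  have hT0 : ∀ n, 0 ≤ T n := fun n => by simp only [hT]; positivity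
  have hlow : ∑ n ∈ range (t + 1), T n ≤
      Real.exp β * Real.exp (-(D : ℝ) ^ 2 / (2 * t)) := by
    calc _ ≤ ∑ n ∈ range (t + 1),
          β ^ n / n.factorial * Real.exp (-(D : ℝ) ^ 2 / (2 * t)) := by
          refine sum_le_sum fun n hn => mul_le_mul_of_nonneg_left ?_ (by positivity)
          rw [div_le_iff₀' (by positivity)]
          exact sum_choose_le_two_pow_mul_exp (Nat.lt_succ_iff.1 (mem_range.1 hn)) htpos
      _ ≤ _ := by
          rw [← sum_mul]
          exact mul_le_mul_of_nonneg_right (Real.sum_le_exp_of_nonneg hβ.le _) (Real.exp_pos _).le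
  have hhigh : ∑ n ∈ Ico (t + 1) (max N (t + 1)), T n ≤
      (1 / 4) * (Real.exp 1 * β / t) ^ t := by
    calc _ ≤ ∑ n ∈ Ico (t + 1) (max N (t + 1)), β ^ n / n.factorial * (1 / 2) := by
          refine sum_le_sum fun n _ => mul_le_mul_of_nonneg_left ?_ (by positivity)
          rw [div_le_iff₀' (by positivity)]
          exact sum_choose_le_half_two_pow hD
      _ ≤ _ := by
          rw [← sum_mul]
          linarith [sum_Ico_pow_div_factorial_le hβ ht (max N (t + 1))]
  calc _ ≤ ∑ n ∈ range N, T n := hN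
    _ ≤ ∑ n ∈ range (max N (t + 1)), T n :=
        sum_le_sum_of_subset_of_nonneg (range_subset_range.2 (le_max_left _ _)) fun n _ _ => hT0 n
    _ = _ := (sum_range_add_sum_Ico T (le_max_right N (t + 1))).symm
    _ ≤ _ := add_le_add hlow hhigh

/-- For `β > 0`, `d ≥ 0` and an integer `t ≥ β`,
`2 e^{-β} ∑_{j=d+1}^∞ I_j(β) ≤ 2 e^{-(d+1)²/(2t)} + (1/2)(eβ/t)^t e^{-β}`. -/
theorem bessel_tail_bound (β : ℝ) (hβ : 0 < β) (d : ℕ) (t : ℕ) (ht : β ≤ (t : ℝ)) :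
    2 * Real.exp (-β) * (∑' m : ℕ, besselI (d + 1 + m) β)
      ≤ 2 * Real.exp (-((d : ℝ) + 1) ^ 2 / (2 * t))
        + (1 / 2) * (Real.exp 1 * β / t) ^ (t : ℕ) * Real.exp (-β) := by
  have hbound := sum_besselTerm_le_exp_add hβ d.succ_pos ht
  have hsummable : Summable fun p : ℕ × ℕ => besselTerm β (d + 1 + p.1) p.2 :=
    summable_of_sum_le (fun _ => besselTerm_nonneg hβ _ _) hbound
  have htsum : ∑' m : ℕ, besselI (d + 1 + m) β =
      ∑' p : ℕ × ℕ, besselTerm β (d + 1 + p.1) p.2 := hsummable.tsum_prod.symm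
  have h := mul_le_mul_of_nonneg_left (hsummable.tsum_le_of_sum_le hbound)
    (by positivity : 0 ≤ 2 * Real.exp (-β))
  rw [htsum]
  refine h.trans_eq ?_
  have hexp : Real.exp (-β) * Real.exp β = 1 := by rw [← Real.exp_add]; simp
  push_cast
  linear_combination 2 * Real.exp (-((d : ℝ) + 1) ^ 2 / (2 * t)) * hexp
end

section
/- For any β > 0 and x ∈ [−1,1], one has erf(√(2β)·x) = 2√(2β/π) e^{-β} [I₀(β)x + ∑_{j=1}^∞ I_j(β)(−1)^j (T_{2j+1}(x)/(2j+1) − T_{2j−1}(x)/(2j−1))], where T_n is the n-th Chebyshev polynomial of the first kind and I_j is the j-th modified Bessel function of the first kind. -/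
open Polynomial

/-- The Gauss error function. -/
noncomputable def erf (y : ℝ) : ℝ :=
  (2 / Real.sqrt Real.pi) * ∫ t in (0:ℝ)..y, Real.exp (-t ^ 2)

/-- Pairs of naturals, parametrised by their difference and their minimum. -/
def intProdNatEquivNatProdNat : ℤ × ℕ ≃ ℕ × ℕ where
  toFun p := (p.2 + p.1.toNat, p.2 + (-p.1).toNat)
  invFun q := ((q.1 : ℤ) - q.2, min q.1 q.2)
  left_inv := by rintro ⟨n, m⟩; ext <;> grind
  right_inv := by rintro ⟨a, b⟩; ext <;> simp <;> omega

theorem choose_div_factorial_two_mul_add {K : Type*} [Field K] [CharZero K] (m j : ℕ) :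
    ((2 * m + j).choose m : K) / (2 * m + j).factorial
      = 1 / ((m + j).factorial * m.factorial) := by
  have h := Nat.add_choose_mul_factorial_mul_factorial m (m + j)
  rw [← Nat.choose_symm_add, show m + (m + j) = 2 * m + j by ring] at h
  have hmul : ((2 * m + j).choose m : K) * m.factorial * (m + j).factorial
      = (2 * m + j).factorial := by exact_mod_cast h
  have h₁ : (m.factorial : K) ≠ 0 := by exact_mod_cast m.factorial_ne_zero
  have h₂ : ((m + j).factorial : K) ≠ 0 := by exact_mod_cast (m + j).factorial_ne_zero
  have h₃ : ((2 * m + j).factorial : K) ≠ 0 := by exact_mod_cast (2 * m + j).factorial_ne_zero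
  rw [div_eq_div_iff h₃ (mul_ne_zero h₂ h₁)]
  linear_combination hmul

theorem exp_series_mul_term (r : ℂ) {u : ℂ} (hu : u ≠ 0) (n : ℤ) (m : ℕ) :
    (r * u) ^ (m + n.toNat) / (m + n.toNat).factorial
        * ((r * u⁻¹) ^ (m + (-n).toNat) / (m + (-n).toNat).factorial)
      = ((2 * m + n.natAbs).choose m : ℂ) * r ^ (2 * m + n.natAbs)
          / (2 * m + n.natAbs).factorial * u ^ n := by
  rw [mul_div_right_comm, choose_div_factorial_two_mul_add]
  have hpow (k : ℕ) : u ^ k * u⁻¹ ^ k = 1 := by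
    rw [← mul_pow, mul_inv_cancel₀ hu, one_pow]
  obtain ⟨j, rfl | rfl⟩ := n.eq_nat_or_neg
  · simp only [Int.toNat_natCast, Int.toNat_neg_natCast, Int.natAbs_natCast, zpow_natCast,
      add_zero, mul_pow, pow_add, pow_mul, div_eq_mul_inv, mul_inv]
    linear_combination (r ^ m * r ^ m * r ^ j * u ^ j * ((m + j).factorial : ℂ)⁻¹
      * (m.factorial : ℂ)⁻¹) * hpow m
  · simp only [Int.toNat_natCast, Int.toNat_neg_natCast, Int.natAbs_natCast, Int.natAbs_neg,
      zpow_natCast, zpow_neg, neg_neg, ← inv_pow,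
      add_zero, mul_pow, pow_add, pow_mul, div_eq_mul_inv, mul_inv]
    linear_combination (r ^ m * r ^ m * r ^ j * u⁻¹ ^ j * ((m + j).factorial : ℂ)⁻¹
      * (m.factorial : ℂ)⁻¹) * hpow m

theorem hasSum_mul_of_hasSum_complex {ι κ : Type*} {f : ι → ℂ} {g : κ → ℂ} {a b : ℂ}
    (hf : HasSum f a) (hg : HasSum g b) :
    HasSum (fun p : ι × κ => f p.1 * g p.2) (a * b) := by
  rw [← hf.tsum_eq, ← hg.tsum_eq,
    tsum_mul_tsum_of_summable_norm hf.summable.norm hg.summable.norm]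
  exact (summable_mul_of_summable_norm hf.summable.norm hg.summable.norm).hasSum

/-- The generating function of the modified Bessel functions of integer order. -/
theorem hasSum_besselI_mul_zpow (β : ℝ) {u : ℂ} (hu : u ≠ 0) :
    HasSum (fun n : ℤ => (besselI n.natAbs β : ℂ) * u ^ n)
      (Complex.exp (β / 2 * (u + u⁻¹))) := by
  have hexp (z : ℂ) : HasSum (fun k : ℕ => z ^ k / k.factorial) (Complex.exp z) := by
    rw [Complex.exp_eq_exp_ℂ]
    exact NormedSpace.expSeries_div_hasSum_exp z
  have hprod : HasSum (fun q : ℕ × ℕ => (β / 2 * u) ^ q.1 / q.1.factorial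
      * ((β / 2 * u⁻¹) ^ q.2 / q.2.factorial)) (Complex.exp (β / 2 * (u + u⁻¹))) := by
    rw [mul_add, Complex.exp_add]
    have h := hasSum_mul_of_hasSum_complex (hexp (β / 2 * u)) (hexp (β / 2 * u⁻¹))
    exact h
  have hfull : HasSum (fun p : ℤ × ℕ => ((2 * p.2 + p.1.natAbs).choose p.2 : ℂ)
      * (β / 2 : ℂ) ^ (2 * p.2 + p.1.natAbs) / (2 * p.2 + p.1.natAbs).factorial * u ^ p.1)
      (Complex.exp (β / 2 * (u + u⁻¹))) := by
    simp_rw [← exp_series_mul_term _ hu]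
    exact intProdNatEquivNatProdNat.hasSum_iff.mpr hprod
  refine hfull.prod_fiberwise fun n => ?_
  have hfib := (hfull.summable.prod_factor n).hasSum
  dsimp only at hfib ⊢
  rw [tsum_mul_right] at hfib
  rw [besselI]
  push_cast
  exact hfib

theorem summable_abs_besselI (β : ℝ) : Summable fun j : ℕ => |besselI j β| := by
  have h := (hasSum_besselI_mul_zpow β one_ne_zero).summable.norm
  simpa [Function.comp_def] using h.comp_injective Nat.cast_injective

/-- The Jacobi–Anger expansion of `exp (-β * y)` on `[-1, 1]`. -/
theorem hasSum_besselI_mul_chebyshev_T (β : ℝ) {y : ℝ} (hy : y ∈ Set.Icc (-1 : ℝ) 1) :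
    HasSum (fun m : ℕ => besselI (m + 1) β * (-1) ^ (m + 1)
        * (2 * (Chebyshev.T ℝ ((m : ℤ) + 1)).eval y))
      (Real.exp (-β * y) - besselI 0 β) := by
  obtain ⟨θ, rfl⟩ : ∃ θ, Real.cos θ = y := ⟨_, Real.cos_arccos hy.1 hy.2⟩
  have hu : -Complex.exp (θ * Complex.I) ≠ 0 := neg_ne_zero.mpr (Complex.exp_ne_zero _)
  have h := (hasSum_nat_add_iff' 1).mpr (hasSum_besselI_mul_zpow β hu).nat_add_neg
  have hinv : (-Complex.exp (θ * Complex.I))⁻¹ = -Complex.exp (-(θ * Complex.I)) := by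
    rw [inv_neg, Complex.exp_neg]
  rw [← Complex.hasSum_ofReal]
  convert! h using 1
  · ext m
    have hc := Complex.two_cos (((m + 1 : ℕ) : ℂ) * θ)
    rw [Chebyshev.T_real_cos, Int.natAbs_neg, Int.natAbs_natCast, zpow_neg, zpow_natCast,
      ← inv_pow, hinv, neg_pow (Complex.exp _), neg_pow (Complex.exp (-_)), ← Complex.exp_nat_mul,
      ← Complex.exp_nat_mul]
    push_cast at hc ⊢
    rw [hc]
    ring_nf
  · have hc := Complex.two_cos (θ : ℂ)
    rw [hinv]
    simp only [Finset.sum_range_one]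
    push_cast
    rw [show (β / 2 : ℂ) * (-Complex.exp (θ * Complex.I) + -Complex.exp (-(θ * Complex.I)))
      = -β * Complex.cos θ by rw [neg_mul] at hc; linear_combination (β / 2 : ℂ) * hc]
    simp

theorem hasDerivAt_chebyshev_T_div_sub (m : ℕ) (s : ℝ) :
    HasDerivAt (fun x => (Chebyshev.T ℝ (2 * ((m : ℤ) + 1) + 1)).eval x / (2 * ((m : ℝ) + 1) + 1)
        - (Chebyshev.T ℝ (2 * ((m : ℤ) + 1) - 1)).eval x / (2 * ((m : ℝ) + 1) - 1))
      (2 * (Chebyshev.T ℝ (2 * ((m : ℤ) + 1))).eval s) s := by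
  have h₁ : (2 * ((m : ℝ) + 1) + 1) ≠ 0 := by positivity
  have h₂ : (2 * ((m : ℝ) + 1) - 1) ≠ 0 := by
    have : (0 : ℝ) ≤ m := m.cast_nonneg
    linarith
  have hT := congrArg (eval s) (Chebyshev.two_mul_T_eq_U_sub_U ℝ (2 * (m : ℤ)))
  convert! ((Chebyshev.T ℝ (2 * ((m : ℤ) + 1) + 1)).hasDerivAt s).div_const _ |>.sub
    (((Chebyshev.T ℝ (2 * ((m : ℤ) + 1) - 1)).hasDerivAt s).div_const _) using 1
  rw [Chebyshev.T_derivative_eq_U, Chebyshev.T_derivative_eq_U]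
  simp only [eval_mul, eval_sub, eval_intCast, eval_ofNat] at hT ⊢
  push_cast
  rw [mul_div_cancel_left₀ _ h₁, mul_div_cancel_left₀ _ h₂]
  ring_nf at hT ⊢
  exact hT

theorem integral_two_mul_chebyshev_T_even (m : ℕ) (x : ℝ) :
    ∫ s in (0 : ℝ)..x, 2 * (Chebyshev.T ℝ (2 * ((m : ℤ) + 1))).eval s
      = (Chebyshev.T ℝ (2 * ((m : ℤ) + 1) + 1)).eval x / (2 * ((m : ℝ) + 1) + 1)
        - (Chebyshev.T ℝ (2 * ((m : ℤ) + 1) - 1)).eval x / (2 * ((m : ℝ) + 1) - 1) := by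
  rw [intervalIntegral.integral_eq_sub_of_hasDerivAt
    (fun s _ => hasDerivAt_chebyshev_T_div_sub m s)
    (Continuous.intervalIntegrable (by fun_prop) _ _)]
  rw [Chebyshev.T_eval_zero_of_odd ℝ (by grind), Chebyshev.T_eval_zero_of_odd ℝ (by grind)]
  simp

theorem hasSum_integral_exp_neg_two_mul_sq (β : ℝ) {x : ℝ} (hx : x ∈ Set.Icc (-1 : ℝ) 1) :
    HasSum (fun m : ℕ => besselI (m + 1) β * (-1) ^ (m + 1) *
        ((Chebyshev.T ℝ (2 * ((m : ℤ) + 1) + 1)).eval x / (2 * ((m : ℝ) + 1) + 1)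
          - (Chebyshev.T ℝ (2 * ((m : ℤ) + 1) - 1)).eval x / (2 * ((m : ℝ) + 1) - 1)))
      (∫ s in (0 : ℝ)..x, (Real.exp (-β * (2 * s ^ 2 - 1)) - besselI 0 β)) := by
  have hmem {s : ℝ} (hs : s ∈ Set.uIoc 0 x) : |s| ≤ 1 := by
    rw [Set.mem_uIoc] at hs
    rw [abs_le]
    constructor <;> rcases hs with hs | hs <;> linarith [hx.1, hx.2, hs.1, hs.2]
  simp only [← integral_two_mul_chebyshev_T_even, ← intervalIntegral.integral_const_mul]
  refine intervalIntegral.hasSum_integral_of_dominated_convergence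
    (fun m _ => 2 * |besselI (m + 1) β|)
    (fun m => Continuous.aestronglyMeasurable (by fun_prop))
    (fun m => .of_forall fun s hs => ?_) (.of_forall fun s hs => ?_)
    intervalIntegrable_const (.of_forall fun s hs => ?_)
  · have hT := Chebyshev.abs_eval_T_real_le_one (2 * ((m : ℤ) + 1)) (hmem hs)
    simp only [Real.norm_eq_abs, abs_mul, abs_pow, abs_neg, abs_one, one_pow, mul_one, abs_two]
    nlinarith [abs_nonneg (besselI (m + 1) β)]
  · exact ((summable_nat_add_iff 1).mpr (summable_abs_besselI β)).mul_left 2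
  · have hs2 : s ^ 2 ≤ 1 := (sq_le_one_iff_abs_le_one s).mpr (hmem hs)
    have hy : 2 * s ^ 2 - 1 ∈ Set.Icc (-1 : ℝ) 1 := ⟨by nlinarith [sq_nonneg s], by linarith⟩
    convert! hasSum_besselI_mul_chebyshev_T β hy using 4 with m
    rw [mul_comm 2, Chebyshev.T_mul, eval_comp, Chebyshev.T_two]
    simp

theorem erf_sqrt_two_mul_mul {β : ℝ} (hβ : 0 < β) (x : ℝ) :
    erf (Real.sqrt (2 * β) * x)
      = 2 * Real.sqrt (2 * β / Real.pi) * Real.exp (-β)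
        * ∫ s in (0 : ℝ)..x, Real.exp (-β * (2 * s ^ 2 - 1)) := by
  have hsub := intervalIntegral.smul_integral_comp_mul_left (a := 0) (b := x)
    (fun t : ℝ => Real.exp (-t ^ 2)) (Real.sqrt (2 * β))
  have hexp (s : ℝ) : Real.exp (-(Real.sqrt (2 * β) * s) ^ 2)
      = Real.exp (-β) * Real.exp (-β * (2 * s ^ 2 - 1)) := by
    rw [← Real.exp_add, mul_pow, Real.sq_sqrt (by positivity)]
    ring_nf
  simp only [mul_zero, hexp, intervalIntegral.integral_const_mul, smul_eq_mul] at hsub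
  rw [erf, ← hsub, Real.sqrt_div (by positivity)]
  ring

/-- Chebyshev expansion of the error function: for `β > 0` and `x ∈ [−1,1]`,
`erf(√(2β)x) = 2√(2β/π) e^{-β} [I₀(β)x + ∑_{j=1}^∞ I_j(β)(−1)^j
(T_{2j+1}(x)/(2j+1) − T_{2j−1}(x)/(2j−1))]`. -/
theorem erf_chebyshev_expansion (β : ℝ) (hβ : 0 < β) (x : ℝ) (hx : x ∈ Set.Icc (-1 : ℝ) 1) :
    erf (Real.sqrt (2 * β) * x)
      = 2 * Real.sqrt (2 * β / Real.pi) * Real.exp (-β) *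
        (besselI 0 β * x +
          ∑' m : ℕ, besselI (m + 1) β * (-1) ^ (m + 1) *
            ((Polynomial.Chebyshev.T ℝ (2 * ((m : ℤ) + 1) + 1)).eval x / (2 * ((m : ℝ) + 1) + 1)
              - (Polynomial.Chebyshev.T ℝ (2 * ((m : ℤ) + 1) - 1)).eval x
                  / (2 * ((m : ℝ) + 1) - 1))) := by
  have hfull : IntervalIntegrable (fun s : ℝ => Real.exp (-β * (2 * s ^ 2 - 1)))
      MeasureTheory.volume 0 x := Continuous.intervalIntegrable (by fun_prop) _ _
  rw [(hasSum_integral_exp_neg_two_mul_sq β hx).tsum_eq, erf_sqrt_two_mul_mul hβ,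
    intervalIntegral.integral_sub hfull intervalIntegrable_const, intervalIntegral.integral_const,
    smul_eq_mul]
  ring
end
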